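/- Let G be a left-compressed 3-graph on vertex set [t] with m edges where C(t−1,3) ≤ m ≤ C(t−1,3) + C(t−2,2), and suppose λ(G) equals the maximum Lagrangian over all 3-graphs with m edges. Then either |[t−1]^{(3)} \ E(G)| ≤ t−3 or λ(G) ≤ λ([t−1]^{(3)}). -/

import Mathlib

open Finset

/-- The polynomial λ(G, w) = Σ_{e ∈ E} Π_{i ∈ e} w i. -/
def lagPoly (E : Finset (Finset ℕ)) (w : ℕ → ℝ) : ℝ :=
  ∑ e ∈ E, ∏ i ∈ e, w i

/-- A feasible weighting on vertex set [n] = {0, …, n-1}. -/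
def IsWeighting (n : ℕ) (w : ℕ → ℝ) : Prop :=
  (∀ i, 0 ≤ w i) ∧ (∀ i, n ≤ i → w i = 0) ∧ ∑ i ∈ Finset.range n, w i = 1

/-- The Lagrangian of a hypergraph with edge set `E`. -/
noncomputable def lag (E : Finset (Finset ℕ)) : ℝ :=
  sSup {x | ∃ n w, IsWeighting n w ∧ x = lagPoly E w}

/-- The complete r-uniform hypergraph on vertex set {0, …, t-1}. -/
def completeG (t r : ℕ) : Finset (Finset ℕ) :=
  (Finset.range t).powersetCard r

/-- A hypergraph is left-compressed if replacing any vertex of an edge by a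
smaller vertex (not already in the edge) again yields an edge. -/
def LeftCompressed (E : Finset (Finset ℕ)) : Prop :=
  ∀ e ∈ E, ∀ j ∈ e, ∀ i < j, i ∉ e → insert i (e.erase j) ∈ E


/-- Weighted sum over `k`-subsets `p` of `R` with `z ∪ p ∈ E`. -/
def Lk (E : Finset (Finset ℕ)) (R : Finset ℕ) (k : ℕ) (z : Finset ℕ) (w : ℕ → ℝ) : ℝ :=
  ∑ p ∈ R.powersetCard k, if z ∪ p ∈ E then ∏ i ∈ p, w i else 0

lemma Lk_split (E : Finset (Finset ℕ)) (R : Finset ℕ) (k : ℕ) (z : Finset ℕ) (w : ℕ → ℝ)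
    (x : ℕ) (hx : x ∉ R) :
    Lk E (insert x R) (k+1) z w = Lk E R (k+1) z w + w x * Lk E R k (insert x z) w := by
  unfold Lk
  rw [Finset.powersetCard_succ_insert hx, Finset.sum_union, Finset.sum_image, Finset.mul_sum]
  · congr 1
    apply Finset.sum_congr rfl
    intro p hp
    rw [Finset.mem_powersetCard] at hp
    have : x ∉ p := fun h => hx (hp.1 h)
    rw [Finset.prod_insert this]
    have e : z ∪ insert x p = insert x z ∪ p := by
      ext y; simp only [mem_union, mem_insert]; tauto
    rw [e]
    split_ifs <;> simp
  · intro p hp q hq h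
    simp only [mem_coe, mem_powersetCard] at hp hq
    have h1 : x ∉ p := fun h => hx (hp.1 h)
    have h2 : x ∉ q := fun h => hx (hq.1 h)
    rw [← Finset.erase_insert h1, ← Finset.erase_insert h2]
    exact congrArg (fun r => Finset.erase r x) h
  · rw [Finset.disjoint_left]
    intro p hp hq
    rw [Finset.mem_powersetCard] at hp
    rw [Finset.mem_image] at hq
    obtain ⟨q, _, rfl⟩ := hq
    exact hx (hp.1 (Finset.mem_insert_self _ _))

lemma Lk_congr (E : Finset (Finset ℕ)) (R : Finset ℕ) (k : ℕ) (z : Finset ℕ) (w w' : ℕ → ℝ)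
    (h : ∀ i ∈ R, w i = w' i) : Lk E R k z w = Lk E R k z w' := by
  unfold Lk
  apply Finset.sum_congr rfl
  intro p hp
  rw [Finset.mem_powersetCard] at hp
  rw [Finset.prod_congr rfl (fun i hi => h i (hp.1 hi))]

lemma Lk_nonneg (E : Finset (Finset ℕ)) (R : Finset ℕ) (k : ℕ) (z : Finset ℕ) (w : ℕ → ℝ)
    (h : ∀ i ∈ R, 0 ≤ w i) : 0 ≤ Lk E R k z w := by
  unfold Lk
  apply Finset.sum_nonneg
  intro p hp
  rw [Finset.mem_powersetCard] at hp
  split_ifs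
  · exact Finset.prod_nonneg (fun i hi => h i (hp.1 hi))
  · exact le_rfl

lemma Lk_lower (E : Finset (Finset ℕ)) (R : Finset ℕ) (k : ℕ) (z : Finset ℕ) (w : ℕ → ℝ) (u : ℝ)
    (hu : 0 ≤ u) (h : ∀ i ∈ R, u ≤ w i) : Lk E R k z (fun _ => 1) * u ^ k ≤ Lk E R k z w := by
  unfold Lk
  rw [Finset.sum_mul]
  apply Finset.sum_le_sum
  intro p hp
  rw [Finset.mem_powersetCard] at hp
  split_ifs
  · have := Finset.prod_le_prod (s := p) (f := fun _ => u) (g := w) (fun _ _ => hu)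
      (fun i hi => h i (hp.1 hi))
    rw [Finset.prod_const, hp.2] at this
    simpa using this
  · simp

lemma Lk_upper (E : Finset (Finset ℕ)) (R : Finset ℕ) (k : ℕ) (z : Finset ℕ) (w : ℕ → ℝ) (a : ℝ)
    (h0 : ∀ i ∈ R, 0 ≤ w i) (h : ∀ i ∈ R, w i ≤ a) :
    Lk E R k z w ≤ Lk E R k z (fun _ => 1) * a ^ k := by
  unfold Lk
  rw [Finset.sum_mul]
  apply Finset.sum_le_sum
  intro p hp
  rw [Finset.mem_powersetCard] at hp
  split_ifs
  · have := Finset.prod_le_prod (s := p) (f := w) (g := fun _ => a) (fun i hi => h0 i (hp.1 hi))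
      (fun i hi => h i (hp.1 hi))
    rw [Finset.prod_const, hp.2] at this
    simpa using this
  · simp

lemma Lk_mono (E E' : Finset (Finset ℕ)) (R : Finset ℕ) (k : ℕ) (z z' : Finset ℕ) (w : ℕ → ℝ)
    (h0 : ∀ i ∈ R, 0 ≤ w i)
    (h : ∀ p ⊆ R, p.card = k → z ∪ p ∈ E → z' ∪ p ∈ E') : Lk E R k z w ≤ Lk E' R k z' w := by
  unfold Lk
  apply Finset.sum_le_sum
  intro p hp
  rw [Finset.mem_powersetCard] at hp
  have hn : 0 ≤ ∏ i ∈ p, w i := Finset.prod_nonneg (fun i hi => h0 i (hp.1 hi))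
  by_cases h1 : z ∪ p ∈ E
  · rw [if_pos h1, if_pos (h p hp.1 hp.2 h1)]
  · rw [if_neg h1]
    split_ifs
    · exact hn
    · exact le_rfl

/-- Sum over `p` splits as those in `E₁` and those in `E₂`. -/
lemma Lk_add (E E₁ E₂ : Finset (Finset ℕ)) (R : Finset ℕ) (k : ℕ) (z z' : Finset ℕ) (w : ℕ → ℝ)
    (h : ∀ p ⊆ R, p.card = k → z' ∪ p ∈ E ∧ ((z ∪ p ∈ E₁ ∧ z ∪ p ∉ E₂) ∨ (z ∪ p ∉ E₁ ∧ z ∪ p ∈ E₂))) :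
    Lk E R k z' w = Lk E₁ R k z w + Lk E₂ R k z w := by
  unfold Lk
  rw [← Finset.sum_add_distrib]
  apply Finset.sum_congr rfl
  intro p hp
  rw [Finset.mem_powersetCard] at hp
  obtain ⟨h1, h2⟩ := h p hp.1 hp.2
  rw [if_pos h1]
  rcases h2 with h2 | h2 <;> simp [h2]

lemma Lk_zero (E : Finset (Finset ℕ)) (R : Finset ℕ) (k : ℕ) (z : Finset ℕ) (w : ℕ → ℝ)
    (h : ∀ p ⊆ R, p.card = k → z ∪ p ∉ E) : Lk E R k z w = 0 := by
  unfold Lk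
  apply Finset.sum_eq_zero
  intro p hp
  rw [Finset.mem_powersetCard] at hp
  rw [if_neg (h p hp.1 hp.2)]

lemma Lk_one (E : Finset (Finset ℕ)) (R : Finset ℕ) (z : Finset ℕ) (w : ℕ → ℝ) :
    Lk E R 1 z w = ∑ r ∈ R, if z ∪ {r} ∈ E then w r else 0 := by
  unfold Lk
  rw [Finset.powersetCard_one, Finset.sum_map]
  simp

lemma lagPoly_eq (E : Finset (Finset ℕ)) (t : ℕ) (hE : E ⊆ (Finset.range t).powersetCard 3)
    (w : ℕ → ℝ) : lagPoly E w = Lk E (Finset.range t) 3 ∅ w := by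
  unfold lagPoly Lk
  simp only [Finset.empty_union]
  rw [← Finset.sum_filter, Finset.filter_mem_eq_inter, Finset.inter_eq_right.2 hE]

lemma range_pair {t i j : ℕ} (hi : i < t) (hj : j < t) :
    Finset.range t = insert i (insert j (((Finset.range t).erase i).erase j)) := by
  ext y; simp only [Finset.mem_insert, Finset.mem_erase, Finset.mem_range]
  omega

lemma decomp (E : Finset (Finset ℕ)) (t : ℕ) (hE : E ⊆ (Finset.range t).powersetCard 3)
    (w : ℕ → ℝ) {i j : ℕ} (hi : i < t) (hj : j < t) (hij : i ≠ j) (R : Finset ℕ)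
    (hR : R = ((Finset.range t).erase i).erase j) :
    lagPoly E w = Lk E R 3 ∅ w + w i * Lk E R 2 {i} w + w j * Lk E R 2 {j} w
      + w i * w j * Lk E R 1 {i, j} w := by
  rw [lagPoly_eq E t hE, range_pair hi hj, ← hR, Lk_split, Lk_split, Lk_split]
  · have : (insert j (insert i (∅ : Finset ℕ))) = {i, j} := by
      ext y; simp; tauto
    rw [this]
    simp only [insert_empty_eq]
    ring
  · simp [hR]
  · simp [hR]
  · simp [hR, hij]

/-- Moving weight `c` from `j` to `i`. -/
def shiftW (w : ℕ → ℝ) (i j : ℕ) (c : ℝ) : ℕ → ℝ :=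
  fun k => if k = i then w i + c else if k = j then w j - c else w k

lemma shift_weighting {t i j : ℕ} {w : ℕ → ℝ} {c : ℝ} (hw : IsWeighting t w)
    (hi : i < t) (hj : j < t) (hij : i ≠ j) (h1 : 0 ≤ w i + c) (h2 : 0 ≤ w j - c) :
    IsWeighting t (shiftW w i j c) := by
  obtain ⟨h0, hz, hs⟩ := hw
  refine ⟨?_, ?_, ?_⟩
  · intro k; unfold shiftW; split_ifs
    · exact h1
    · exact h2
    · exact h0 k
  · intro k hk; unfold shiftW
    rw [if_neg (by omega), if_neg (by omega)]; exact hz k hk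
  · rw [range_pair hi hj] at hs ⊢
    rw [Finset.sum_insert (by simp [hij]), Finset.sum_insert (by simp)] at hs ⊢
    have : ∑ k ∈ ((Finset.range t).erase i).erase j, shiftW w i j c k
        = ∑ k ∈ ((Finset.range t).erase i).erase j, w k := by
      apply Finset.sum_congr rfl
      intro k hk
      simp only [Finset.mem_erase] at hk
      simp [shiftW, hk.1, hk.2.1]
    rw [this]
    simp only [shiftW, if_true, if_neg hij.symm]
    linarith

lemma shift_lag (E : Finset (Finset ℕ)) (t : ℕ) (hE : E ⊆ (Finset.range t).powersetCard 3)
    (w : ℕ → ℝ) {i j : ℕ} (hi : i < t) (hj : j < t) (hij : i ≠ j) (R : Finset ℕ)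
    (hR : R = ((Finset.range t).erase i).erase j) (c : ℝ) :
    lagPoly E (shiftW w i j c) = lagPoly E w
      + c * (Lk E R 2 {i} w - Lk E R 2 {j} w + (w j - w i) * Lk E R 1 {i,j} w)
      - c ^ 2 * Lk E R 1 {i, j} w := by
  rw [decomp E t hE _ hi hj hij R hR, decomp E t hE w hi hj hij R hR]
  have hc : ∀ k z, Lk E R k z (shiftW w i j c) = Lk E R k z w := by
    intro k z
    apply Lk_congr
    intro l hl
    rw [hR] at hl
    simp only [Finset.mem_erase] at hl
    simp [shiftW, hl.1, hl.2.1]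
  rw [hc, hc, hc, hc]
  simp only [shiftW, if_true, if_neg hij.symm]
  ring

lemma first_order_le (E : Finset (Finset ℕ)) (t : ℕ) (hE : E ⊆ (Finset.range t).powersetCard 3)
    (w : ℕ → ℝ) (hw : IsWeighting t w)
    (hmax : ∀ n w', IsWeighting n w' → lagPoly E w' ≤ lagPoly E w)
    {i j : ℕ} (hi : i < t) (hj : j < t) (hij : i ≠ j) (hpos : 0 < w j) (R : Finset ℕ)
    (hR : R = ((Finset.range t).erase i).erase j) :
    Lk E R 2 {i} w - Lk E R 2 {j} w + (w j - w i) * Lk E R 1 {i,j} w ≤ 0 := by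
  by_contra hcon
  push Not at hcon
  set G := Lk E R 2 {i} w - Lk E R 2 {j} w + (w j - w i) * Lk E R 1 {i,j} w with hG
  set C := Lk E R 1 {i,j} w with hC
  have hC0 : 0 ≤ C := Lk_nonneg _ _ _ _ _ (fun k _ => hw.1 k)
  set c := min (w j) (G / (C + 1)) with hc
  have hcpos : 0 < c := lt_min hpos (by positivity)
  have hc1 : c ≤ w j := min_le_left _ _
  have hc2 : c * (C + 1) ≤ G := by
    have : c ≤ G / (C+1) := min_le_right _ _
    rwa [le_div_iff₀ (by positivity)] at this
  have h := hmax t _ (shift_weighting (c := c) hw hi hj hij (by have := hw.1 i; linarith)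
    (by linarith))
  rw [shift_lag E t hE w hi hj hij R hR, ← hC, ← hG] at h
  nlinarith

lemma first_order (E : Finset (Finset ℕ)) (t : ℕ) (hE : E ⊆ (Finset.range t).powersetCard 3)
    (w : ℕ → ℝ) (hw : IsWeighting t w)
    (hmax : ∀ n w', IsWeighting n w' → lagPoly E w' ≤ lagPoly E w)
    {i j : ℕ} (hi : i < t) (hj : j < t) (hij : i ≠ j) (hposi : 0 < w i) (hpos : 0 < w j)
    (R : Finset ℕ) (hR : R = ((Finset.range t).erase i).erase j) :
    (w i - w j) * Lk E R 1 {i,j} w = Lk E R 2 {i} w - Lk E R 2 {j} w := by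
  have h1 := first_order_le E t hE w hw hmax hi hj hij hpos R hR
  have h2 := first_order_le E t hE w hw hmax hj hi hij.symm hposi R
    (by rw [hR, Finset.erase_right_comm])
  rw [Finset.pair_comm j i] at h2
  linarith

lemma exists_max (E : Finset (Finset ℕ)) (t : ℕ) (ht : 0 < t)
    (hE : E ⊆ (Finset.range t).powersetCard 3) :
    ∃ x, IsWeighting t x ∧ ∀ n w, IsWeighting n w → lagPoly E w ≤ lagPoly E x := by
  let ext0 : (Fin t → ℝ) → ℕ → ℝ := fun z i => if h : i < t then z ⟨i, h⟩ else 0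
  have hcont : Continuous (fun z => lagPoly E (ext0 z)) := by
    unfold lagPoly
    apply continuous_finsetSum
    intro e _
    apply continuous_finsetProd
    intro i _
    by_cases h : i < t
    · simp only [ext0, h, dif_pos]; fun_prop
    · simp only [ext0, h, dif_neg, not_false_eq_true]; fun_prop
  have hne : (stdSimplex ℝ (Fin t)).Nonempty := ⟨_, single_mem_stdSimplex ℝ (⟨0, ht⟩ : Fin t)⟩
  obtain ⟨z, hz, hzmax⟩ := (isCompact_stdSimplex ℝ (Fin t)).exists_isMaxOn hne hcont.continuousOn
  refine ⟨ext0 z, ⟨?_, ?_, ?_⟩, ?_⟩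
  · intro i; simp only [ext0]; split_ifs
    · exact hz.1 _
    · exact le_rfl
  · intro i hi; simp only [ext0]; rw [dif_neg (by omega)]
  · rw [Finset.sum_range]
    simp only [ext0, Fin.is_lt, dif_pos]
    exact hz.2
  · intro n w hw
    obtain ⟨h0, hzero, hs⟩ := hw
    have hle : ∑ i ∈ Finset.range t, w i ≤ 1 := by
      rw [← hs]
      have h1 : ∑ i ∈ Finset.range t, w i ≤ ∑ i ∈ Finset.range (max t n), w i :=
        Finset.sum_le_sum_of_subset_of_nonneg (Finset.range_mono (le_max_left _ _))
          (fun i _ _ => h0 i)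
      have h2 : ∑ i ∈ Finset.range n, w i = ∑ i ∈ Finset.range (max t n), w i := by
        apply Finset.sum_subset (Finset.range_mono (le_max_right _ _))
        intro i _ hi
        apply hzero
        simpa using hi
      linarith
    set d := 1 - ∑ i ∈ Finset.range t, w i with hd
    let z' : Fin t → ℝ := fun i => w i + if (i : ℕ) = 0 then d else 0
    have hz' : z' ∈ stdSimplex ℝ (Fin t) := by
      constructor
      · intro i
        simp only [z']
        have := h0 i
        split_ifs <;> linarith
      · simp only [z']
        rw [← Finset.sum_range (fun i => w i + if i = 0 then d else 0), Finset.sum_add_distrib,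
          Finset.sum_ite_eq', if_pos (by simpa using ht)]
        linarith
    refine le_trans ?_ (hzmax hz')
    unfold lagPoly
    apply Finset.sum_le_sum
    intro e he
    apply Finset.prod_le_prod
    · intro i _; exact h0 i
    · intro i hi
      have := (Finset.mem_powersetCard.1 (hE he)).1 hi
      rw [Finset.mem_range] at this
      simp only [ext0, this, dif_pos, z']
      split_ifs <;> linarith

lemma le_lag (E : Finset (Finset ℕ)) (t : ℕ) (ht : 0 < t)
    (hE : E ⊆ (Finset.range t).powersetCard 3) (n : ℕ) (w : ℕ → ℝ) (hw : IsWeighting n w) :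
    lagPoly E w ≤ lag E := by
  obtain ⟨x, _, hx⟩ := exists_max E t ht hE
  apply le_csSup
  · exact ⟨lagPoly E x, by rintro _ ⟨n, w, hw, rfl⟩; exact hx n w hw⟩
  · exact ⟨n, w, hw, rfl⟩

lemma lag_le (E : Finset (Finset ℕ)) (t : ℕ) (x : ℕ → ℝ) (hx : IsWeighting t x)
    (hmax : ∀ n w, IsWeighting n w → lagPoly E w ≤ lagPoly E x) : lag E ≤ lagPoly E x := by
  apply csSup_le
  · exact ⟨_, t, x, hx, rfl⟩
  · rintro _ ⟨n, w, hw, rfl⟩; exact hmax n w hw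

lemma weighting_drop {t : ℕ} {x : ℕ → ℝ} (hx : IsWeighting (t+1) x) (h : x t = 0) :
    IsWeighting t x := by
  obtain ⟨h0, hz, hs⟩ := hx
  refine ⟨h0, ?_, ?_⟩
  · intro i hi
    rcases Nat.eq_or_lt_of_le hi with h' | h'
    · rw [← h']; exact h
    · exact hz i h'
  · rw [Finset.sum_range_succ, h, add_zero] at hs; exact hs

/-- With `x t = 0`, only sets inside `range t` matter. -/
lemma lagPoly_drop (E : Finset (Finset ℕ)) (t : ℕ)
    (hE : E ⊆ (Finset.range (t+1)).powersetCard 3) (x : ℕ → ℝ) (h : x t = 0) :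
    lagPoly E x = Lk E (Finset.range t) 3 ∅ x := by
  rw [lagPoly_eq E _ hE, Finset.range_add_one, Lk_split _ _ _ _ _ _ (by simp), h]
  simp

lemma zero_case (E : Finset (Finset ℕ)) (t : ℕ) (ht : 0 < t)
    (hE : E ⊆ (Finset.range (t+1)).powersetCard 3) (x : ℕ → ℝ) (hx : IsWeighting (t+1) x)
    (i : ℕ) (hi : i < t + 1) (hxi : x i = 0) :
    lagPoly E x ≤ lag (completeG t 3) := by
  have hF : completeG (t+1) 3 ⊆ (Finset.range (t+1)).powersetCard 3 := le_rfl
  have h1 : lagPoly E x ≤ lagPoly (completeG (t+1) 3) x := by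
    rw [lagPoly_eq _ _ hE, lagPoly_eq _ _ hF]
    apply Lk_mono
    · intro i _; exact hx.1 i
    · intro p _ _ hp; exact hE hp
  have key : ∃ y, IsWeighting (t+1) y ∧ y t = 0 ∧
      lagPoly (completeG (t+1) 3) x = lagPoly (completeG (t+1) 3) y := by
    by_cases hit : i = t
    · exact ⟨x, hx, hit ▸ hxi, rfl⟩
    · refine ⟨shiftW x i t (x t), shift_weighting hx hi (by omega) hit ?_ ?_, ?_, ?_⟩
      · rw [hxi, zero_add]; exact hx.1 t
      · simp
      · simp [shiftW, Ne.symm hit]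
      · rw [shift_lag _ _ hF x hi (by omega : t < t+1) hit _ rfl, hxi]
        set R := ((Finset.range (t+1)).erase i).erase t with hR
        have : Lk (completeG (t+1) 3) R 2 {i} x = Lk (completeG (t+1) 3) R 2 {t} x := by
          have aux : ∀ l, l < t + 1 → l ∉ R → ∀ p ⊆ R, p.card = 2 →
              {l} ∪ p ∈ completeG (t+1) 3 := by
            intro l hl hlR p hp hc
            unfold completeG
            rw [Finset.mem_powersetCard]
            have hlp : l ∉ p := fun h => hlR (hp h)
            rw [← Finset.insert_eq, Finset.card_insert_of_notMem hlp, hc]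
            refine ⟨?_, rfl⟩
            intro y hy
            rcases Finset.mem_insert.1 hy with rfl | hy
            · simpa using hl
            · have := hp hy
              rw [hR] at this
              exact Finset.mem_of_mem_erase (Finset.mem_of_mem_erase this)
          apply le_antisymm <;> apply Lk_mono _ _ _ _ _ _ _ (fun k _ => hx.1 k)
          · intro p hp hc _
            exact aux t (by omega) (by simp [hR]) p hp hc
          · intro p hp hc _
            exact aux i (by omega) (by simp [hR]) p hp hc
        rw [this]; ring
  obtain ⟨y, hy, hyt, hxy⟩ := key
  have h2 : lagPoly (completeG (t+1) 3) y = lagPoly (completeG t 3) y := by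
    rw [lagPoly_drop _ _ hF _ hyt, lagPoly_eq (completeG t 3) t le_rfl]
    apply le_antisymm <;> apply Lk_mono _ _ _ _ _ _ _ (fun k _ => hy.1 k)
    · intro p hp hc _
      simpa [completeG] using ⟨hp, hc⟩
    · intro p hp hc _
      simp only [completeG, empty_union, mem_powersetCard]
      exact ⟨hp.trans (Finset.range_mono (by omega)), hc⟩
  rw [hxy, h2] at h1
  exact h1.trans (le_lag _ t ht le_rfl t y (weighting_drop hy hyt))

lemma numeric (a u v X S M b n cA cT : ℝ) (hb : 1 ≤ b) (hn : 1 ≤ n) (hau : u ≤ a) (huv : v ≤ u)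
    (hv : 0 < v) (hX : X = 1 - b * a - u - v) (hX0 : 0 ≤ X) (hXn : X ≤ n * a)
    (hS : cA * u ^ 2 ≤ S) (hM : cT * u ^ 3 ≤ M) (hM0 : 0 ≤ M) (hS0 : 0 ≤ S) (hc : b + n ≤ cA + cT)
    (hrel : (a - u) * (1 - a - u) = S + v * X) :
    b * a * v ^ 2 ≤ M + (u + v) * S := by
  have hu : 0 < u := by linarith
  have ha : 0 < a := by linarith
  obtain ⟨d, rfl⟩ : ∃ d, a = u + d := ⟨a - u, by ring⟩
  have hd : 0 ≤ d := by linarith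
  have hSe : S = d * ((b - 1) * (u + d)) + X * (d - v) + v * d := by
    have : (1 : ℝ) = X + b * (u + d) + u + v := by linarith
    have h2 : S = (u + d - u) * (1 - (u + d) - u) - v * X := by linarith
    rw [h2]
    have h3 : 1 - (u + d) - u = X + (b - 1) * (u + d) + v := by linarith
    rw [h3]; ring
  rcases le_total v d with hvd | hvd
  · have h1 : 0 ≤ X * (d - v) := mul_nonneg hX0 (by linarith)
    have h2 : (u + v) * (d * ((b - 1) * (u + d)) + v * d) ≤ (u + v) * S :=
      mul_le_mul_of_nonneg_left (by linarith) (by linarith)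
    have h3 : (b - 1) * (u + d) * v ^ 2 ≤ (b - 1) * (u + d) * ((u + v) * d) := by
      apply mul_le_mul_of_nonneg_left _ (mul_nonneg (by linarith) (by linarith))
      nlinarith [mul_pos hu hv]
    have h4 : (u + d) * v ^ 2 ≤ (u + v) * (v * d) := by
      have : 0 ≤ u * v * (d - v) := mul_nonneg (mul_nonneg hu.le hv.le) (by linarith)
      nlinarith
    nlinarith
  · -- multiply the goal by `a = u + d`
    have e1 : b * (u + d) * d = S + X * (v - d) + d * (u + d - v) := by rw [hSe]; ring
    have e2 : 0 ≤ (v * (u + d) - v ^ 2) * S :=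
      mul_nonneg (by nlinarith) hS0
    have e3 : cA * u ^ 2 * (u * (u + d)) ≤ S * (u * (u + d)) :=
      mul_le_mul_of_nonneg_right hS (by positivity)
    have e4 : cT * u ^ 3 * (u + d) ≤ M * (u + d) := mul_le_mul_of_nonneg_right hM ha.le
    have e5 : (b + n) * (u ^ 3 * (u + d)) ≤ (cA + cT) * (u ^ 3 * (u + d)) :=
      mul_le_mul_of_nonneg_right hc (by positivity)
    have hvu2 : v ^ 2 ≤ u ^ 2 := pow_le_pow_left₀ hv.le huv 2
    have hvu3 : v ^ 3 ≤ u ^ 3 := pow_le_pow_left₀ hv.le huv 3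
    have e6 : b * (u + d) * u * v ^ 2 ≤ b * (u + d) * u * u ^ 2 :=
      mul_le_mul_of_nonneg_left hvu2 (by positivity)
    have e7 : n * (u + d) * v ^ 3 ≤ n * (u + d) * u ^ 3 :=
      mul_le_mul_of_nonneg_left hvu3 (by positivity)
    have e8 : X * (v - d) ≤ n * (u + d) * (v - d) :=
      mul_le_mul_of_nonneg_right hXn (by linarith)
    have e9 : d * (u + d - v) ≤ n * (u + d) * d := by
      have : d * (u + d) ≤ n * (d * (u + d)) :=
        le_mul_of_one_le_left (by positivity) hn
      nlinarith
    have e10 : v ^ 2 * (X * (v - d) + d * (u + d - v)) ≤ v ^ 2 * (n * (u + d) * v) :=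
      mul_le_mul_of_nonneg_left (by linarith) (by positivity)
    have fin : b * (u + d) * v ^ 2 * (u + d) ≤ (M + (u + v) * S) * (u + d) := by
      have : b * (u + d) * v ^ 2 * (u + d)
          = b * (u + d) * u * v ^ 2 + v ^ 2 * (b * (u + d) * d) := by ring
      rw [this, e1]
      nlinarith
    exact le_of_mul_le_mul_right fin ha

/-- Every triple through a vertex `r` with `{r,s,s+1} ∈ E` is an edge. -/
lemma dominated (E : Finset (Finset ℕ)) (s : ℕ) (hlc : LeftCompressed E) (r : ℕ) (hr : r < s)
    (h : ({s, s+1, r} : Finset ℕ) ∈ E) (e : Finset ℕ) (he : e ∈ completeG (s+2) 3) (hre : r ∈ e) :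
    e ∈ E := by
  have step1 : ∀ p, p < s → p ≠ r → ({p, s+1, r} : Finset ℕ) ∈ E := by
    intro p hp hpr
    have := hlc _ h s (by simp) p hp (by simp; omega)
    convert this using 1
    ext y; simp only [mem_insert, mem_erase, mem_singleton]; omega
  have step2 : ∀ q, q < s + 1 → q ≠ r → ∀ p, p < q → p ≠ r → ({p, q, r} : Finset ℕ) ∈ E := by
    intro q hq hqr p hp hpr
    rcases Nat.lt_or_ge q s with hqs | hqs
    · have := hlc _ (step1 p (by omega) hpr) (s+1) (by simp) q (by omega) (by simp; omega)
      convert this using 1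
      ext y; simp only [mem_insert, mem_erase, mem_singleton]; omega
    · have := hlc _ h (s+1) (by simp) p (by omega) (by simp; omega)
      convert this using 1
      ext y; simp only [mem_insert, mem_erase, mem_singleton]; omega
  have step3 : ∀ q, q < s + 2 → q ≠ r → ∀ p, p < q → p ≠ r → ({p, q, r} : Finset ℕ) ∈ E := by
    intro q hq hqr p hp hpr
    rcases Nat.lt_or_ge q (s+1) with hqs | hqs
    · exact step2 q hqs hqr p hp hpr
    · obtain rfl : q = s + 1 := by omega
      rcases Nat.lt_or_ge p s with hps | hps
      · exact step1 p hps hpr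
      · obtain rfl : p = s := by omega
        exact h
  unfold completeG at he
  rw [Finset.mem_powersetCard] at he
  obtain ⟨hsub, hcard⟩ := he
  have hc2 : (e.erase r).card = 2 := by rw [Finset.card_erase_of_mem hre, hcard]
  obtain ⟨p, q, hpq, hpqe⟩ := Finset.card_eq_two.1 hc2
  have hp : p ∈ e.erase r := by rw [hpqe]; simp
  have hq : q ∈ e.erase r := by rw [hpqe]; simp
  have hp2 := hsub (Finset.mem_of_mem_erase hp)
  have hq2 := hsub (Finset.mem_of_mem_erase hq)
  rw [Finset.mem_range] at hp2 hq2
  have hee : e = insert r {p, q} := by rw [← hpqe, Finset.insert_erase hre]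
  rcases Nat.lt_or_ge p q with h' | h'
  · have := step3 q hq2 (Finset.ne_of_mem_erase hq) p h' (Finset.ne_of_mem_erase hp)
    rw [hee]; convert this using 1
    ext y; simp only [mem_insert, mem_singleton]; omega
  · have := step3 p hp2 (Finset.ne_of_mem_erase hp) q (by omega) (Finset.ne_of_mem_erase hq)
    rw [hee]; convert this using 1
    ext y; simp only [mem_insert, mem_singleton]; omega

lemma sorted_aux (E : Finset (Finset ℕ)) (t : ℕ) (hE : E ⊆ (Finset.range t).powersetCard 3)
    (hlc : LeftCompressed E) (w : ℕ → ℝ) (hw : IsWeighting t w)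
    (hmax : ∀ n w', IsWeighting n w' → lagPoly E w' ≤ lagPoly E w)
    (hpos : ∀ i < t, 0 < w i)
    (hcov : ∀ i < t, ∀ j < t, i ≠ j → ∃ r < t, r ≠ i ∧ r ≠ j ∧ ({i, j} ∪ {r} : Finset ℕ) ∈ E)
    {i j : ℕ} (hij : i < j) (hj : j < t) : w j ≤ w i := by
  have hi : i < t := by omega
  have h := first_order E t hE w hw hmax hi hj (by omega) (hpos i hi) (hpos j hj) _ rfl
  set R := ((Finset.range t).erase i).erase j with hR
  have h1 : Lk E R 2 {j} w ≤ Lk E R 2 {i} w := by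
    apply Lk_mono _ _ _ _ _ _ _ (fun k _ => hw.1 k)
    intro p hp hc hpE
    have hip : i ∉ p := fun h => by have := hp h; simp [hR] at this
    have hjp : j ∉ p := fun h => by have := hp h; simp [hR] at this
    have := hlc _ hpE j (by simp) i hij (by simp [hip]; omega)
    rw [← Finset.insert_eq, Finset.erase_insert hjp] at this
    rwa [← Finset.insert_eq]
  have h2 : 0 < Lk E R 1 {i, j} w := by
    rw [Lk_one]
    apply Finset.sum_pos'
    · intro k _; split_ifs
      · exact hw.1 k
      · exact le_rfl
    · obtain ⟨r, hr, hri, hrj, hrE⟩ := hcov i hi j hj (by omega)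
      refine ⟨r, by simp [hR, hr, hri, hrj], ?_⟩
      rw [if_pos hrE]; exact hpos r hr
  by_contra hcon
  push Not at hcon
  nlinarith

lemma Lk_one_nat (E : Finset (Finset ℕ)) (R z : Finset ℕ) :
    Lk E R 1 z (fun _ => 1) = ((R.filter (fun r => z ∪ {r} ∈ E)).card : ℝ) := by
  rw [Lk_one]; simp

lemma main_pos (s : ℕ) (hs : 0 < s) (E : Finset (Finset ℕ))
    (hE : E ⊆ (Finset.range (s+2)).powersetCard 3) (hlc : LeftCompressed E)
    (x : ℕ → ℝ) (hx : IsWeighting (s+2) x)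
    (hmax : ∀ n w', IsWeighting n w' → lagPoly E w' ≤ lagPoly E x)
    (hpos : ∀ i < s + 2, 0 < x i)
    (hN : s ≤ (completeG (s+1) 3 \ E).card) :
    lagPoly E x ≤ lag (completeG (s+1) 3) := by
  set Ec := completeG (s+2) 3 \ E with hEc
  have hRs : Finset.range s = ((Finset.range (s+2)).erase s).erase (s+1) := by
    ext y; simp; omega
  have hmem : ∀ e, e ∈ completeG (s+2) 3 → ((e ∈ E ∧ e ∉ Ec) ∨ (e ∉ E ∧ e ∈ Ec)) := by
    intro e he
    by_cases h : e ∈ E <;> simp [hEc, h, he]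
  -- the merged weighting
  set y := shiftW x s (s+1) (x (s+1)) with hy
  have hyw : IsWeighting (s+2) y := by
    apply shift_weighting hx (by omega) (by omega) (by omega)
    · exact add_nonneg (hx.1 _) (hx.1 _)
    · simp
  have hyz : y (s+1) = 0 := by simp [hy, shiftW]
  have hys : y s = x s + x (s+1) := by simp [hy, shiftW]
  have hyr : ∀ i ∈ Finset.range s, y i = x i := by
    intro i hi
    rw [Finset.mem_range] at hi
    simp only [hy, shiftW]
    rw [if_neg (by omega), if_neg (by omega)]
  have hfo := first_order E _ hE x hx hmax (i := s) (j := s+1) (by omega) (by omega) (by omega)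
    (hpos _ (by omega)) (hpos _ (by omega)) _ hRs
  have hmerge : lagPoly E y = lagPoly E x - x (s+1) ^ 2 * Lk E (Finset.range s) 1 {s, s+1} x := by
    rw [hy, shift_lag E _ hE x (i := s) (j := s+1) (by omega) (by omega) (by omega) _ hRs]
    linear_combination (-x (s+1)) * hfo
  have hcomp : lagPoly (completeG (s+1) 3) y = lagPoly E y + Lk Ec (Finset.range (s+1)) 3 ∅ y := by
    rw [lagPoly_drop E _ hE y hyz, lagPoly_eq (completeG (s+1) 3) (s+1) le_rfl]
    apply Lk_add
    intro p hp hc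
    rw [Finset.empty_union]
    refine ⟨Finset.mem_powersetCard.2 ⟨hp, hc⟩, hmem _ ?_⟩
    exact Finset.mem_powersetCard.2 ⟨hp.trans (Finset.range_mono (by omega)), hc⟩
  have hM : Lk Ec (Finset.range (s+1)) 3 ∅ y = Lk Ec (Finset.range s) 3 ∅ x
      + (x s + x (s+1)) * Lk Ec (Finset.range s) 2 {s} x := by
    rw [Finset.range_add_one, Lk_split _ _ _ _ _ _ (by simp), hys, Lk_congr _ _ _ _ _ _ hyr,
      Lk_congr _ _ _ _ _ _ hyr]
    simp
  have hfinal := le_lag (completeG (s+1) 3) (s+1) (by omega) le_rfl (s+1) y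
    (weighting_drop hyw hyz)
  suffices hkey : x (s+1) ^ 2 * Lk E (Finset.range s) 1 {s, s+1} x ≤
      Lk Ec (Finset.range s) 3 ∅ x + (x s + x (s+1)) * Lk Ec (Finset.range s) 2 {s} x by
    linarith
  have hS0 : 0 ≤ Lk Ec (Finset.range s) 2 {s} x := Lk_nonneg _ _ _ _ _ (fun k _ => hx.1 k)
  have hM0 : 0 ≤ Lk Ec (Finset.range s) 3 ∅ x := Lk_nonneg _ _ _ _ _ (fun k _ => hx.1 k)
  by_cases hK : ∃ r < s, ({s, s+1} ∪ {r} : Finset ℕ) ∈ E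
  swap
  · have : Lk E (Finset.range s) 1 {s, s+1} x = 0 := by
      rw [Lk_one]
      apply Finset.sum_eq_zero
      intro r hr
      rw [if_neg]
      intro h
      exact hK ⟨r, by simpa using hr, h⟩
    rw [this, mul_zero]
    exact add_nonneg hM0 (mul_nonneg (add_nonneg (hx.1 _) (hx.1 _)) hS0)
  have hun : ∀ r, ({s, s+1} ∪ {r} : Finset ℕ) = {s, s+1, r} := by
    intro r; ext y; simp only [mem_union, mem_insert, mem_singleton]; tauto
  have hdom : ∀ r < s, ({s, s+1} ∪ {r} : Finset ℕ) ∈ E → ∀ e ∈ completeG (s+2) 3, r ∈ e → e ∈ E := by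
    intro r hr h
    rw [hun] at h
    exact dominated E s hlc r hr h
  have h0K : ({s, s+1} ∪ {0} : Finset ℕ) ∈ E := by
    obtain ⟨r, hr, h⟩ := hK
    rcases Nat.eq_zero_or_pos r with rfl | hr0
    · exact h
    · have := hlc _ h r (by simp) 0 hr0 (by simp; omega)
      convert this using 1
      ext y; simp only [mem_union, mem_insert, mem_erase, mem_singleton]; omega
  have h0dom := hdom 0 hs h0K
  have tri : ∀ i j k, i < s + 2 → j < s + 2 → k < s + 2 → i ≠ j → i ≠ k → j ≠ k →
      ({i, j, k} : Finset ℕ) ∈ completeG (s+2) 3 := by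
    intro i j k hi hj hk hij hik hjk
    unfold completeG
    rw [Finset.mem_powersetCard]
    refine ⟨?_, Finset.card_eq_three.2 ⟨i, j, k, hij, hik, hjk, rfl⟩⟩
    intro y; simp only [mem_insert, mem_singleton, mem_range]; omega
  have hun' : ∀ i j r, ({i, j} ∪ {r} : Finset ℕ) = {i, j, r} := by
    intro i j r; ext y; simp only [mem_union, mem_insert, mem_singleton]; tauto
  have hcov : ∀ i < s + 2, ∀ j < s + 2, i ≠ j →
      ∃ r < s + 2, r ≠ i ∧ r ≠ j ∧ ({i, j} ∪ {r} : Finset ℕ) ∈ E := by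
    intro i hi j hj hij
    by_cases h0 : i = 0 ∨ j = 0
    · obtain ⟨r, hr, hri, hrj⟩ : ∃ r < s + 2, r ≠ i ∧ r ≠ j := by
        by_cases h1 : i ≠ 1 ∧ j ≠ 1
        · exact ⟨1, by omega, by omega, by omega⟩
        · exact ⟨2, by omega, by omega, by omega⟩
      refine ⟨r, hr, hri, hrj, h0dom _ ?_ ?_⟩
      · rw [hun']; exact tri _ _ _ hi hj hr hij hri.symm hrj.symm
      · rcases h0 with h0 | h0 <;> simp [h0]
    · refine ⟨0, by omega, by omega, by omega, h0dom _ ?_ (by simp)⟩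
      rw [hun']; exact tri _ _ _ hi hj (by omega) hij (by omega) (by omega)
  have hsort : ∀ i j, i < j → j < s + 2 → x j ≤ x i := fun i j hij hj =>
    sorted_aux E _ hE hlc x hx hmax hpos hcov hij hj
  have hle0 : ∀ i < s + 2, x i ≤ x 0 := by
    intro i hi
    rcases Nat.eq_zero_or_pos i with rfl | h
    · exact le_rfl
    · exact hsort 0 i h hi
  have hpair : ∀ l < s + 2, ∀ R ⊆ Finset.range (s+2), l ∉ R → ∀ p ⊆ R, p.card = 2 →
      {l} ∪ p ∈ completeG (s+2) 3 := by
    intro l hl R hR hlR p hp hc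
    unfold completeG
    have hlp : l ∉ p := fun h => hlR (hp h)
    rw [Finset.mem_powersetCard, ← Finset.insert_eq, Finset.card_insert_of_notMem hlp, hc]
    exact ⟨Finset.insert_subset (by simpa using hl) (hp.trans hR), rfl⟩
  -- weights on K are all equal
  have hKeq : ∀ r < s, ({s, s+1} ∪ {r} : Finset ℕ) ∈ E → x r = x 0 := by
    intro r hr hrE
    rcases Nat.eq_zero_or_pos r with rfl | hr0
    · rfl
    · apply le_antisymm (hle0 r (by omega))
      have h := first_order E _ hE x hx hmax (i := 0) (j := r) (by omega) (by omega) (by omega)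
        (hpos _ (by omega)) (hpos _ (by omega)) _ rfl
      set R := ((Finset.range (s+2)).erase 0).erase r with hR
      have hRsub : R ⊆ Finset.range (s+2) := (Finset.erase_subset _ _).trans (Finset.erase_subset _ _)
      have h1 : Lk E R 2 {0} x ≤ Lk E R 2 {r} x := by
        apply Lk_mono _ _ _ _ _ _ _ (fun k _ => hx.1 k)
        intro p hp hc _
        exact hdom r hr hrE _ (hpair r (by omega) R hRsub (by simp [hR]) p hp hc) (by simp)
      have h2 : 0 < Lk E R 1 {0, r} x := by
        rw [Lk_one]
        apply Finset.sum_pos'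
        · intro k _; split_ifs
          · exact hx.1 k
          · exact le_rfl
        · obtain ⟨q, hq, hqi, hqj, hqE⟩ := hcov 0 (by omega) r (by omega) (by omega)
          refine ⟨q, by simp only [hR, mem_erase, mem_range]; exact ⟨hqj, hqi, hq⟩, ?_⟩
          rw [if_pos hqE]; exact hpos q hq
      by_contra hcon
      push Not at hcon
      nlinarith
  set b := Lk E (Finset.range s) 1 {s, s+1} (fun _ => 1) with hb
  set n := Lk Ec (Finset.range s) 1 {s, s+1} (fun _ => 1) with hn
  set X := Lk Ec (Finset.range s) 1 {s, s+1} x with hX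
  set S := Lk Ec (Finset.range s) 2 {s} x with hS
  set M := Lk Ec (Finset.range s) 3 ∅ x with hMd
  have hba : Lk E (Finset.range s) 1 {s, s+1} x = b * x 0 := by
    rw [hb, Lk_one, Lk_one, Finset.sum_mul]
    apply Finset.sum_congr rfl
    intro r hr
    rw [Finset.mem_range] at hr
    split_ifs with h
    · rw [hKeq r hr h, one_mul]
    · simp
  have hmemr : ∀ r < s, ({s, s+1} ∪ {r} : Finset ℕ) ∈ completeG (s+2) 3 := by
    intro r hr
    rw [hun']; exact tri _ _ _ (by omega) (by omega) (by omega) (by omega) (by omega) (by omega)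
  have hsum1 : ∀ w : ℕ → ℝ, ∑ r ∈ Finset.range s, w r =
      Lk E (Finset.range s) 1 {s, s+1} w + Lk Ec (Finset.range s) 1 {s, s+1} w := by
    intro w
    rw [Lk_one, Lk_one, ← Finset.sum_add_distrib]
    apply Finset.sum_congr rfl
    intro r hr
    rw [Finset.mem_range] at hr
    rcases hmem _ (hmemr r hr) with h | h
    · rw [if_pos h.1, if_neg h.2, add_zero]
    · rw [if_neg h.1, if_pos h.2, zero_add]
  have hbn : b + n = s := by
    rw [hb, hn, ← hsum1]; simp
  have hXe : X = 1 - b * x 0 - x s - x (s+1) := by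
    have h := hx.2.2
    rw [Finset.sum_range_succ, Finset.sum_range_succ, hsum1, hba] at h
    linarith
  have hb1 : 1 ≤ b := by
    rw [hb, Lk_one_nat]
    have : 0 < ((Finset.range s).filter (fun r => ({s, s+1} ∪ {r} : Finset ℕ) ∈ E)).card :=
      Finset.card_pos.2 ⟨0, by simp only [mem_filter, mem_range]; exact ⟨hs, h0K⟩⟩
    exact_mod_cast this
  have hn1 : 1 ≤ n := by
    obtain ⟨e, he⟩ : (completeG (s+1) 3 \ E).Nonempty := Finset.card_pos.1 (by omega)
    rw [Finset.mem_sdiff] at he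
    have he1 := Finset.mem_powersetCard.1 he.1
    have hec : e ∈ completeG (s+2) 3 :=
      Finset.mem_powersetCard.2 ⟨he1.1.trans (Finset.range_mono (by omega)), he1.2⟩
    obtain ⟨r, hr, hrs⟩ : ∃ r ∈ e, r ≠ s := Finset.exists_mem_ne (by omega) s
    have hrs' : r < s := by have := he1.1 hr; rw [Finset.mem_range] at this; omega
    rw [hn, Lk_one_nat]
    have : 0 < ((Finset.range s).filter (fun r => ({s, s+1} ∪ {r} : Finset ℕ) ∈ Ec)).card := by
      refine Finset.card_pos.2 ⟨r, ?_⟩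
      simp only [mem_filter, mem_range]
      refine ⟨hrs', ?_⟩
      rcases hmem _ (hmemr r hrs') with h | h
      · exact absurd (hdom r hrs' h.1 e hec hr) he.2
      · exact h.2
    exact_mod_cast this
  have hX0 : 0 ≤ X := Lk_nonneg _ _ _ _ _ (fun k _ => hx.1 k)
  have hXn : X ≤ n * x 0 := by
    have := Lk_upper Ec (Finset.range s) 1 {s, s+1} x (x 0) (fun k _ => hx.1 k)
      (fun i hi => hle0 i (by rw [Finset.mem_range] at hi; omega))
    simpa using this
  have hlow : ∀ i ∈ Finset.range s, x s ≤ x i := by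
    intro i hi
    rw [Finset.mem_range] at hi
    exact hsort i s hi (by omega)
  have hSl := Lk_lower Ec (Finset.range s) 2 {s} x (x s) (hx.1 s) hlow
  have hMl := Lk_lower Ec (Finset.range s) 3 ∅ x (x s) (hx.1 s) hlow
  have hcount : b + n ≤ Lk Ec (Finset.range s) 2 {s} (fun _ => 1)
      + Lk Ec (Finset.range s) 3 ∅ (fun _ => 1) := by
    have h1 : Lk Ec (Finset.range (s+1)) 3 ∅ (fun _ => 1) = ((completeG (s+1) 3 \ E).card : ℝ) := by
      unfold Lk
      simp only [Finset.empty_union, Finset.prod_const_one]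
      rw [Finset.sum_boole]
      congr 2
      ext e
      simp only [mem_filter, hEc, mem_sdiff, completeG, mem_powersetCard]
      constructor
      · rintro ⟨h1, _, h2⟩; exact ⟨h1, h2⟩
      · rintro ⟨h1, h2⟩
        exact ⟨h1, ⟨h1.1.trans (Finset.range_mono (by omega)), h1.2⟩, h2⟩
    rw [Finset.range_add_one, Lk_split _ _ _ _ _ _ (by simp)] at h1
    simp only [insert_empty_eq, one_mul] at h1
    rw [hbn]
    have : (s : ℝ) ≤ ((completeG (s+1) 3 \ E).card : ℝ) := by exact_mod_cast hN
    linarith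
  have hrel : (x 0 - x s) * (1 - x 0 - x s) = S + x (s+1) * X := by
    have h := first_order E _ hE x hx hmax (i := 0) (j := s) (by omega) (by omega) (by omega)
      (hpos _ (by omega)) (hpos _ (by omega)) _ rfl
    set R := ((Finset.range (s+2)).erase 0).erase s with hR
    have hRsub : R ⊆ Finset.range (s+2) := (Finset.erase_subset _ _).trans (Finset.erase_subset _ _)
    have hC : Lk E R 1 {0, s} x = 1 - x 0 - x s := by
      have h3 := hx.2.2
      rw [range_pair (i := 0) (j := s) (by omega) (by omega),
        Finset.sum_insert (by simp; omega), Finset.sum_insert (by simp), ← hR] at h3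
      have : Lk E R 1 {0, s} x = ∑ r ∈ R, x r := by
        rw [Lk_one]
        apply Finset.sum_congr rfl
        intro r hr
        have hr' := hRsub hr
        simp only [hR, mem_erase, mem_range] at hr hr'
        rw [if_pos]
        apply h0dom _ _ (by simp)
        rw [hun']
        exact tri _ _ _ (by omega) (by omega) hr' (by omega) (by omega) (by omega)
      rw [this]; linarith
    have hA : Lk E R 2 {0} x = Lk E R 2 {s} x + Lk Ec R 2 {s} x := by
      apply Lk_add
      intro p hp hc
      exact ⟨h0dom _ (hpair 0 (by omega) R hRsub (by simp [hR]) p hp hc) (by simp),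
        hmem _ (hpair s (by omega) R hRsub (by simp [hR]) p hp hc)⟩
    rw [hC, hA] at h
    have hRe : R = insert (s+1) ((Finset.range s).erase 0) := by
      ext y; simp only [hR, mem_insert, mem_erase, mem_range]; omega
    have hRe2 : Finset.range s = insert 0 ((Finset.range s).erase 0) := by
      rw [Finset.insert_erase (by simpa using hs)]
    have hz0 : ∀ k z, Lk Ec ((Finset.range s).erase 0) k (insert 0 z) x = 0 := by
      intro k z
      apply Lk_zero
      intro p _ _ hpE
      rw [hEc, Finset.mem_sdiff] at hpE
      exact hpE.2 (h0dom _ hpE.1 (by simp))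
    have hS' : S = Lk Ec ((Finset.range s).erase 0) 2 {s} x := by
      rw [hS]
      conv_lhs => rw [hRe2]
      rw [Lk_split _ _ _ _ _ _ (by simp), hz0, mul_zero, add_zero]
    have hX' : X = Lk Ec ((Finset.range s).erase 0) 1 {s, s+1} x := by
      rw [hX]
      conv_lhs => rw [hRe2]
      rw [Lk_split _ _ _ _ _ _ (by simp), hz0, mul_zero, add_zero]
    have hsp : Lk Ec R 2 {s} x = S + x (s+1) * X := by
      rw [hS', hX', hRe, Lk_split _ _ _ _ _ _ (by simp), Finset.pair_comm]
    rw [hsp] at h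
    linarith
  have := numeric (x 0) (x s) (x (s+1)) X S M b n _ _ hb1 hn1 (hle0 s (by omega))
    (hsort s (s+1) (by omega) (by omega)) (hpos _ (by omega)) hXe hX0 hXn hSl hMl hM0 hS0 hcount hrel
  rw [hba]
  linarith

/-- For a left-compressed 3-graph on [t] with m edges attaining the maximum
Lagrangian among all 3-graphs with m edges: |[t-1]^{(3)} \ E| ≤ t-3 or
λ(G) ≤ λ([t-1]^{(3)}). (Vertices 0,…,t-1.) -/
theorem stmt_17 (m t : ℕ)
    (h₁ : (t - 1).choose 3 ≤ m)
    (h₂ : m ≤ (t - 1).choose 3 + (t - 2).choose 2)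
    (E : Finset (Finset ℕ)) (hE : E ⊆ (Finset.range t).powersetCard 3)
    (hmE : E.card = m) (hlc : LeftCompressed E)
    (hopt : ∀ E' : Finset (Finset ℕ), (∀ e ∈ E', e.card = 3) → E'.card = m →
      lag E' ≤ lag E) :
    (completeG (t - 1) 3 \ E).card ≤ t - 3 ∨
    lag E ≤ lag (completeG (t - 1) 3) := by 
  clear hopt h₁ h₂ hmE
  rcases Nat.lt_or_ge t 3 with ht | ht
  · left
    have : completeG (t - 1) 3 = ∅ := by
      unfold completeG
      apply Finset.powersetCard_eq_empty.2
      rw [Finset.card_range]; omega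
    simp [this]
  · obtain ⟨s, rfl⟩ : ∃ s, t = s + 2 := ⟨t - 2, by omega⟩
    rw [show s + 2 - 1 = s + 1 by omega]
    by_cases hN : (completeG (s+1) 3 \ E).card ≤ s + 2 - 3
    · exact Or.inl hN
    · right
      obtain ⟨x, hx, hmax⟩ := exists_max E (s+2) (by omega) hE
      refine (lag_le E _ x hx hmax).trans ?_
      by_cases hpos : ∀ i < s + 2, 0 < x i
      · exact main_pos s (by omega) E hE hlc x hx hmax hpos (by omega)
      · push Not at hpos
        obtain ⟨i, hi, hxi⟩ := hpos
        exact zero_case E (s+1) (by omega) hE x hx i hi (le_antisymm hxi (hx.1 i))
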